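/- If T is a finite transducer with input alphabet A and output alphabet B, and ω is an eventually strongly almost periodic sequence over A such that the output T(ω) is infinite, then T(ω) is an eventually strongly almost periodic sequence over B. -/

import Mathlib

/-- The segment of a sequence `ω` of length `l` starting at position `i`,
i.e. the string `ω(i)ω(i+1)…ω(i+l-1)`. -/
def seg {A : Type*} (ω : ℕ → A) (i l : ℕ) : List A :=
  List.ofFn (fun k : Fin l => ω (i + k))

/-- The string `x` occurs in the sequence `ω` starting at position `i`. -/
def OccursAt {A : Type*} (ω : ℕ → A) (x : List A) (i : ℕ) : Prop :=
  seg ω i x.length = x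

/-- A sequence is strongly almost periodic if every string occurring in it
occurs in every segment of some fixed length `l`. -/
def StronglyAP {A : Type*} (ω : ℕ → A) : Prop :=
  ∀ x : List A, (∃ i, OccursAt ω x i) →
    ∃ l, ∀ i, ∃ j, i ≤ j ∧ j + x.length ≤ i + l ∧ OccursAt ω x j

/-- The sequence `aν` obtained by prepending the finite string `a` to the sequence `ν`. -/
def appendSeq {A : Type*} (a : List A) (ν : ℕ → A) : ℕ → A :=
  fun n => if h : n < a.length then a[n]'h else ν (n - a.length)

/-- A sequence is eventually strongly almost periodic if it equals `aν` for some finite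
string `a` and strongly almost periodic sequence `ν`. -/
def EventuallySAP {A : Type*} (ω : ℕ → A) : Prop :=
  ∃ (a : List A) (ν : ℕ → A), StronglyAP ν ∧ ω = appendSeq a ν

/-- The state of the finite transducer with translation function `f` and initial state
`init` before reading the `n`-th symbol of the input sequence `α`. -/
def transState {A Q B : Type*} (f : Q × A → Q × List B) (init : Q) (α : ℕ → A) : ℕ → Q
  | 0 => init
  | n + 1 => (f (transState f init α n, α n)).1

/-- The finite string output by the transducer upon reading the `n`-th input symbol. -/
def transOut {A Q B : Type*} (f : Q × A → Q × List B) (init : Q) (α : ℕ → A) (n : ℕ) :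
    List B :=
  (f (transState f init α n, α n)).2

/-- The total length of the strings `v 0, …, v (n-1)`, i.e. the position in the
concatenation `v₀v₁v₂…` where `v n` starts. -/
def concatPos {B : Type*} (v : ℕ → List B) (n : ℕ) : ℕ :=
  ∑ m ∈ Finset.range n, (v m).length

/-- The concatenation `v₀v₁v₂…` is infinite. -/
def ConcatInfinite {B : Type*} (v : ℕ → List B) : Prop :=
  ∀ N, ∃ n, N < concatPos v n

/-- The sequence `β` is the concatenation `v₀v₁v₂…` of the finite strings `v n`. -/
def IsConcatOf {B : Type*} (β : ℕ → B) (v : ℕ → List B) : Prop :=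
  ∀ n k, ∀ hk : k < (v n).length, β (concatPos v n + k) = (v n)[k]'hk

theorem occursAt_iff {A : Type*} {α : ℕ → A} {x : List A} {i : ℕ} :
    OccursAt α x i ↔ ∀ k, ∀ hk : k < x.length, α (i + k) = x[k]'hk := by
  unfold OccursAt seg
  constructor
  · intro h k hk
    have := List.getElem_of_eq h (i := k) (by simpa using hk)
    simpa using this
  · intro h
    apply List.ext_getElem
    · simp
    · intro k h1 h2
      simpa using h k h2

/-- Strong almost periodicity in terms of positions: every segment recurs with bounded gaps. -/
theorem stronglyAP_iff {A : Type*} {α : ℕ → A} :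
    StronglyAP α ↔ ∀ i l, ∃ K, ∀ m, ∃ j, m ≤ j ∧ j ≤ m + K ∧ ∀ k < l, α (j + k) = α (i + k) := by
  constructor
  · intro h i l
    have hlen : (seg α i l).length = l := by simp [seg]
    obtain ⟨K, hK⟩ := h (seg α i l) ⟨i, by unfold OccursAt; rw [hlen]⟩
    refine ⟨K, fun m => ?_⟩
    obtain ⟨j, hj1, hj2, hj3⟩ := hK m
    refine ⟨j, hj1, by omega, fun k hk => ?_⟩
    rw [occursAt_iff.1 hj3 k (by omega)]
    simp [seg]
  · rintro h x ⟨i, hi⟩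
    obtain ⟨K, hK⟩ := h i x.length
    refine ⟨K + x.length, fun m => ?_⟩
    obtain ⟨j, hj1, hj2, hj3⟩ := hK m
    refine ⟨j, hj1, by omega, occursAt_iff.2 fun k hk => ?_⟩
    rw [hj3 k hk, occursAt_iff.1 hi k hk]

theorem StronglyAP.shift {A : Type*} {α : ℕ → A} (h : StronglyAP α) (n : ℕ) :
    StronglyAP fun k => α (n + k) := by
  rw [stronglyAP_iff] at h ⊢
  intro i l
  obtain ⟨K, hK⟩ := h (n + i) l
  refine ⟨K, fun m => ?_⟩
  obtain ⟨j, hj1, hj2, hj3⟩ := hK (n + m)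
  refine ⟨j - n, by omega, by omega, fun k hk => ?_⟩
  have := hj3 k hk
  rwa [show j + k = n + (j - n + k) by omega, add_assoc] at this

theorem eventuallySAP_iff {A : Type*} {α : ℕ → A} :
    EventuallySAP α ↔ ∃ n, StronglyAP fun k => α (n + k) := by
  constructor
  · rintro ⟨a, ν, hν, rfl⟩
    refine ⟨a.length, ?_⟩
    simpa [appendSeq] using hν
  · rintro ⟨n, hn⟩
    refine ⟨List.ofFn fun k : Fin n => α k, _, hn, ?_⟩
    funext k
    by_cases hk : k < n
    · simp [appendSeq, hk]
    · simp [appendSeq, hk, Nat.add_sub_cancel' (not_lt.1 hk)]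

section Transducer

variable {A Q B : Type*} (f : Q × A → Q × List B)

theorem transState_add (q : Q) (α : ℕ → A) (m n : ℕ) :
    transState f q α (m + n) =
      transState f (transState f q α m) (fun k => α (m + k)) n := by
  induction n with
  | zero => rfl
  | succ n ih => rw [← add_assoc, transState, transState, ih]

theorem transState_congr (q : Q) {α α' : ℕ → A} {n : ℕ} (h : ∀ k < n, α k = α' k) :
    transState f q α n = transState f q α' n := by
  induction n with
  | zero => rfl
  | succ n ih => rw [transState, transState, ih fun k hk => h k (by omega), h n (by omega)]

theorem transOut_add (q : Q) (α : ℕ → A) (m n : ℕ) :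
    transOut f q α (m + n) = transOut f (transState f q α m) (fun k => α (m + k)) n := by
  rw [transOut, transOut, transState_add]

theorem transOut_congr (q : Q) {α α' : ℕ → A} {n l : ℕ} (hn : n < l)
    (h : ∀ k < l, α k = α' k) : transOut f q α n = transOut f q α' n := by
  rw [transOut, transOut, transState_congr f q fun k hk => h k (by omega), h n hn]

/-- If the prefix of length `a` of `α` collapses the state set as much as any prefix of `α` does,
then every longer prefix recurs with bounded gaps in such a way that the states reached
after the first `a` symbols are those reached at time `a`. -/
theorem exists_recurrence_transState [Finite Q] {α : ℕ → A} (hα : StronglyAP α) (a : ℕ)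
    (hmin : ∀ n, (Set.range fun q => transState f q α a).ncard ≤
      (Set.range fun q => transState f q α n).ncard) (l : ℕ) :
    ∃ K, ∀ m, ∃ j, m ≤ j ∧ j ≤ m + K ∧ (∀ k < a + l, α (j + k) = α k) ∧
      ∀ q, transState f q α (j + a) = transState f q α a := by
  rw [stronglyAP_iff] at hα
  set e : ℕ → Q → Q := fun n q => transState f q α n with he
  let good : Set (Q → Q) → Prop := fun H => ∀ L, ∃ m, ∀ j, m ≤ j → j ≤ m + L →
    (∀ k < a + l, α (j + k) = α k) → e (j + a) ∈ H
  obtain ⟨H, hH⟩ : ∃ H, Minimal good H :=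
    Set.Finite.exists_minimal (Set.toFinite {H | good H})
      ⟨Set.univ, fun _ => ⟨0, fun _ _ _ _ => Set.mem_univ _⟩⟩
  -- every member of `H` is hit with bounded gaps inside windows confined to `H`
  have hgap : ∀ h : Q → Q, ∃ K, h ∈ H → ∀ m, ∃ j, m ≤ j ∧ j ≤ m + K ∧
      (∀ k < a + l, α (j + k) = α k) ∧ (e (j + a) ∈ H → e (j + a) = h) := by
    intro h
    by_cases hh : h ∈ H
    · have hn : ¬ good (H \ {h}) := fun hg =>
        (hH.le_of_le hg Set.sdiff_subset hh).2 rfl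
      simp only [good, not_forall, not_exists] at hn
      obtain ⟨K, hK⟩ := hn
      refine ⟨K, fun _ m => ?_⟩
      obtain ⟨j, h1, h2, h3, h4⟩ := hK m
      refine ⟨j, h1, h2, h3, fun h5 => ?_⟩
      by_contra h6
      exact h4 ⟨h5, h6⟩
    · exact ⟨0, fun h' => absurd h' hh⟩
  choose Kf hKf using hgap
  obtain ⟨K, hK⟩ := (Set.finite_range Kf).bddAbove
  refine ⟨K, fun m => ?_⟩
  obtain ⟨R, hR⟩ := hα 0 (m + K + a + l)
  obtain ⟨w, hw⟩ := hH.prop (R + (m + K))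
  obtain ⟨t, ht1, ht2, ht3⟩ := hR w
  simp only [zero_add] at ht3
  have htH : e (t + a) ∈ H :=
    hw t ht1 (by omega) fun k hk => ht3 k (by omega)
  obtain ⟨j, hj1, hj2, hj3, hj4⟩ := hKf _ htH (t + m)
  have hKt : Kf (e (t + a)) ≤ K := hK ⟨_, rfl⟩
  have hje := hj4 (hw j (by omega) (by omega) hj3)
  obtain ⟨s, rfl⟩ : ∃ s, j = t + s := ⟨j - t, by omega⟩
  -- reading from position `t` acts like reading from position `0`
  have hshift : ∀ n ≤ m + K + a + l, ∀ q, e (t + n) q = e n (e t q) := by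
    intro n hn q
    simp only [he]
    rw [transState_add]
    exact transState_congr f _ fun k hk => ht3 k (by omega)
  have hrange : Set.range (e (t + a)) = Set.range (e a) := by
    apply Set.eq_of_subset_of_ncard_le _ (hmin _) (Set.toFinite _)
    rintro _ ⟨q, rfl⟩
    exact ⟨e t q, (hshift a (by omega) q).symm⟩
  have hsα : ∀ k < a + l, α (s + k) = α k := fun k hk => by
    rw [← hj3 k hk, add_assoc, ht3 (s + k) (by omega)]
  refine ⟨s, by omega, by omega, hsα, fun q => ?_⟩
  obtain ⟨r, hr⟩ : e a q ∈ Set.range (e (t + a)) := hrange ▸ ⟨q, rfl⟩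
  have h1 : ∀ p, e (s + a) p = transState f (e a p) (fun k => α (a + k)) s := fun p => by
    simp only [he]
    rw [add_comm s a, transState_add]
  change e (s + a) q = e a q
  rw [h1, ← hr, hshift a (by omega), ← h1, ← hshift _ (by omega), ← add_assoc, hje,
    hshift a (by omega)]

end Transducer

section Concat

variable {B : Type*}

theorem concatPos_add (v : ℕ → List B) (m n : ℕ) :
    concatPos v (m + n) = concatPos v m + concatPos (fun k => v (m + k)) n := by
  simp [concatPos, Finset.sum_range_add]

theorem concatPos_congr {v w : ℕ → List B} {n : ℕ} (h : ∀ k < n, v k = w k) :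
    concatPos v n = concatPos w n :=
  Finset.sum_congr rfl fun k hk => by rw [h k (Finset.mem_range.1 hk)]

theorem concatPos_le {v : ℕ → List B} {C : ℕ} (hC : ∀ n, (v n).length ≤ C) (n : ℕ) :
    concatPos v n ≤ n * C := by
  simpa [concatPos] using Finset.sum_le_card_nsmul (Finset.range n) _ C fun k _ => hC k

theorem ConcatInfinite.shift {v : ℕ → List B} (h : ConcatInfinite v) (n : ℕ) :
    ConcatInfinite fun k => v (n + k) := by
  intro N
  obtain ⟨m, hm⟩ := h (concatPos v n + N)
  refine ⟨m, ?_⟩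
  have h1 := concatPos_add v n m
  have h2 := concatPos_add v m n
  rw [add_comm m n] at h2
  omega

theorem IsConcatOf.shift {β : ℕ → B} {v : ℕ → List B} (h : IsConcatOf β v) (n : ℕ) :
    IsConcatOf (fun k => β (concatPos v n + k)) fun k => v (n + k) := by
  intro m k hk
  simpa [concatPos_add, add_assoc] using h (n + m) k hk

theorem exists_concatPos_add {v : ℕ → List B} {n r : ℕ} (hr : r < concatPos v n) :
    ∃ m < n, ∃ k < (v m).length, r = concatPos v m + k := by
  induction n with
  | zero => simp [concatPos] at hr
  | succ n ih =>
    rcases lt_or_ge r (concatPos v n) with h | h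
    · obtain ⟨m, hm, k, hk, rfl⟩ := ih h
      exact ⟨m, by omega, k, hk, rfl⟩
    · rw [concatPos, Finset.sum_range_succ] at hr
      refine ⟨n, by omega, r - concatPos v n, ?_, by omega⟩
      unfold concatPos at h ⊢
      omega

/-- If every initial run of blocks recurs with bounded gaps, the concatenation of these blocks
is strongly almost periodic. -/
theorem IsConcatOf.stronglyAP {β : ℕ → B} {v : ℕ → List B} (hβ : IsConcatOf β v)
    (hinf : ConcatInfinite v) {C : ℕ} (hC : ∀ n, (v n).length ≤ C)
    (hrec : ∀ l, ∃ K, ∀ m, ∃ j, m ≤ j ∧ j ≤ m + K ∧ ∀ k < l, v (j + k) = v k) :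
    StronglyAP β := by
  rw [stronglyAP_iff]
  intro i l
  obtain ⟨n, hn⟩ := hinf (i + l)
  obtain ⟨K, hK⟩ := hrec n
  refine ⟨C + K * C + i, fun m => ?_⟩
  obtain ⟨s, hs1, hs2⟩ : ∃ s, m ≤ concatPos v s ∧ concatPos v s ≤ m + C := by
    obtain ⟨n', hn'⟩ := hinf m
    obtain ⟨p, -, k, hk, hp⟩ := exists_concatPos_add hn'
    have hsucc : concatPos v (p + 1) = concatPos v p + (v p).length :=
      Finset.sum_range_succ _ _
    have := hC p
    exact ⟨p + 1, by omega, by omega⟩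
  obtain ⟨j, hj1, hj2, hj3⟩ := hK s
  obtain ⟨d, rfl⟩ : ∃ d, j = s + d := ⟨j - s, by omega⟩
  have hd : concatPos v (s + d) ≤ concatPos v s + K * C := by
    rw [concatPos_add]
    have h1 := concatPos_le (v := fun k => v (s + k)) (fun k => hC (s + k)) d
    have h2 : d * C ≤ K * C := Nat.mul_le_mul_right C (by omega)
    omega
  have hs3 : concatPos v s ≤ concatPos v (s + d) := by
    rw [concatPos_add]
    omega
  refine ⟨concatPos v (s + d) + i, by omega, by omega, fun k hk => ?_⟩
  obtain ⟨p, hp, r, hr, hpr⟩ := exists_concatPos_add (show i + k < concatPos v n by omega)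
  have hpos : concatPos (fun k => v (s + d + k)) p = concatPos v p :=
    concatPos_congr fun k hk => hj3 k (by omega)
  have h1 := (hβ.shift (s + d)) p r (by simpa [hj3 p hp] using hr)
  simp only [hpos] at h1
  rw [add_assoc, hpr, h1, hβ p r hr]
  simp [hj3 p hp]

end Concat

/-- If `T` is a finite transducer with input alphabet `A` and output alphabet `B`, `ω` is
an eventually strongly almost periodic sequence over `A`, and the output `T(ω) = v₀v₁v₂…`
is an infinite sequence `β`, then `β` is an eventually strongly almost periodic sequence
over `B`. -/
theorem transducer_preserves_eventuallySAP {A B : Type*} [Fintype A] [Fintype B]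
    (Q : Type*) [Fintype Q] (f : Q × A → Q × List B) (init : Q)
    (ω : ℕ → A) (hω : EventuallySAP ω) (β : ℕ → B)
    (hinf : ConcatInfinite (transOut f init ω))
    (hβ : IsConcatOf β (transOut f init ω)) :
    EventuallySAP β := by
  obtain ⟨i, hi⟩ := eventuallySAP_iff.1 hω
  let rank : ℕ → ℕ := fun n =>
    (Set.range fun q => transState f q (fun k => ω (i + k)) n).ncard
  set a := Function.argmin rank
  have hrec := exists_recurrence_transState f hi a fun n => Function.argmin_le rank n
  have hv : ∀ n, transOut f init ω (i + a + n) =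
      transOut f (transState f init ω (i + a)) (fun k => ω (i + a + k)) n :=
    transOut_add f init ω (i + a)
  obtain ⟨C, hC⟩ := (Set.finite_range fun x => (f x).2.length).bddAbove
  refine eventuallySAP_iff.2 ⟨concatPos (transOut f init ω) (i + a),
    (hβ.shift (i + a)).stronglyAP (hinf.shift (i + a)) (C := C) (fun n => hC ⟨_, rfl⟩) ?_⟩
  intro l
  obtain ⟨K, hK⟩ := hrec l
  refine ⟨K, fun m => ?_⟩
  obtain ⟨j, hj1, hj2, hj3, hj4⟩ := hK m
  refine ⟨j, hj1, hj2, fun k hk => ?_⟩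
  have hstate : transState f init ω (i + a + j) = transState f init ω (i + a) := by
    rw [add_assoc, add_comm a j, transState_add, hj4, ← transState_add]
  rw [← add_assoc, transOut_add, hstate, transOut_add]
  refine transOut_congr f _ hk fun k hk => ?_
  have := hj3 (a + k) (by omega)
  rwa [show i + (j + (a + k)) = i + a + j + k by omega, ← add_assoc] at this
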